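/- (Stability II.) Let Ω ⊂ ℝ^d be bounded, open and connected, let δ₀ > 0, M₀ > 0, and fix ĥ ∈ (0,1]^d with maximum component 1. Let B₁ be a finite subset of the closed unit ball of ℝ^d minus the origin with −s ∈ B₁ whenever s ∈ B₁, and let ω : B₁ → [0,∞) satisfy ω(−s) = ω(s). Assume: (a) the set {s ∈ B₁ : ω(s)ρ(|s|) > 0} is not contained in any hyperplane through the origin; and (b) for every ξ ∈ [−π,π]^d with ξ ≠ 0, Σ_{s∈B₁} ω(s) ρ(|s|) (1 − cos(M₀ s · (ξ ⊘ ĥ))) > 0, where (ξ ⊘ ĥ)_j = ξ_j/ĥ_j. For δ > 0 define the quasi-discrete nonlocal operator (L^ε_δ u)(x) := 2 Σ_{s∈B₁} δ^d ω(s) ρ_δ(δ|s|)(u(x + δs) − u(x)). Then there exists C > 0 depending only on Ω, δ₀, M₀, ĥ, ρ, d, B₁ and ω such that for every δ ∈ (0, δ₀], taking h := (δ/M₀) ĥ, and every u ∈ S(□∩Ω): |r^h_Ω(−L^ε_δ u)|_h ≥ C ‖u‖_{L²(ℝ^d)}. -/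

import Mathlib

open MeasureTheory Real
open scoped BigOperators

noncomputable section

/-- The cubic B-spline window function. -/
def phi (x : ℝ) : ℝ :=
  if x ≤ 1/2 then 2/3 - 4*x^2 + 4*x^3
  else if x ≤ 1 then (4/3)*(1-x)^3
  else 0

/-- Grid point `x_k = (k₁h₁, …, k_d h_d)`. -/
def gridPt (d : ℕ) (h : Fin d → ℝ) (k : Fin d → ℤ) : EuclideanSpace ℝ (Fin d) :=
  (EuclideanSpace.equiv (Fin d) ℝ).symm (fun j => (k j : ℝ) * h j)

/-- Linear RK basis function `Ψ_k`. -/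
def Psi (d : ℕ) (h : Fin d → ℝ) (k : Fin d → ℤ) (x : EuclideanSpace ℝ (Fin d)) : ℝ :=
  ∏ j, phi (|x j - (k j : ℝ) * h j| / (2 * h j))

/-- The RK function `i^h(c) = Σ_k Ψ_k c_k` with coefficient sequence `c`. -/
def RKfun (d : ℕ) (h : Fin d → ℝ) (c : (Fin d → ℤ) → ℝ) (x : EuclideanSpace ℝ (Fin d)) : ℝ :=
  ∑' k : Fin d → ℤ, Psi d h k x * c k

/-- The norm `|(c_k)|_h := ‖i^h(c)‖_{L²(ℝ^d)}`. -/
def seqNorm (d : ℕ) (h : Fin d → ℝ) (c : (Fin d → ℤ) → ℝ) : ℝ :=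
  Real.sqrt (∫ x : EuclideanSpace ℝ (Fin d), (RKfun d h c x)^2)

/-- The rescaled kernel `ρ_δ(r) = δ^{-(d+2)} ρ(r/δ)`. -/
def rhoScaled (d : ℕ) (ρ : ℝ → ℝ) (δ : ℝ) (r : ℝ) : ℝ :=
  (δ ^ (d + 2))⁻¹ * ρ (r / δ)

/-- The quasi-discrete nonlocal diffusion operator
`L^ε_δ u(x) = 2 Σ_{s∈B₁} δ^d ω(s) ρ_δ(δ|s|)(u(x+δs) − u(x))`. -/
def quasiOp (d : ℕ) (ρ : ℝ → ℝ) (B₁ : Finset (EuclideanSpace ℝ (Fin d)))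
    (ω : EuclideanSpace ℝ (Fin d) → ℝ) (δ : ℝ) (u : EuclideanSpace ℝ (Fin d) → ℝ)
    (x : EuclideanSpace ℝ (Fin d)) : ℝ :=
  2 * ∑ s ∈ B₁, δ^d * ω s * rhoScaled d ρ δ (δ * ‖s‖) * (u (x + δ • s) - u x)

/- The restriction `r^h_Ω v`. -/
open Classical in
def restrSeq (d : ℕ) (h : Fin d → ℝ) (Ω : Set (EuclideanSpace ℝ (Fin d)))
    (v : EuclideanSpace ℝ (Fin d) → ℝ) (k : Fin d → ℤ) : ℝ :=
  if gridPt d h k ∈ Ω then v (gridPt d h k) else 0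

open scoped FourierTransform

/-- One-dimensional cubic B-spline. -/
def bsp (x : ℝ) : ℝ := phi (|x| / 2)

lemma phi_continuous : Continuous phi := by
  unfold phi
  refine Continuous.if_le (by fun_prop) ?_ continuous_id continuous_const ?_
  · refine Continuous.if_le (by fun_prop) (by fun_prop) continuous_id continuous_const ?_
    intro x hx; rw [hx]; norm_num
  · intro x hx; rw [hx]; norm_num

lemma bsp_continuous : Continuous bsp := by
  unfold bsp
  exact phi_continuous.comp (by fun_prop)

lemma bsp_zero {x : ℝ} (h : 2 ≤ |x|) : bsp x = 0 := by
  unfold bsp phi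
  rw [if_neg (by linarith)]
  split_ifs with h1
  · have : |x| / 2 = 1 := by linarith
    rw [this]; norm_num
  · rfl

lemma bsp_neg (x : ℝ) : bsp (-x) = bsp x := by simp [bsp]

lemma bsp_compact : HasCompactSupport bsp := by
  refine HasCompactSupport.intro (K := Set.Icc (-2) 2) isCompact_Icc ?_
  intro x hx
  apply bsp_zero
  by_contra h
  push Not at h
  rw [abs_lt] at h
  exact hx ⟨h.1.le, h.2.le⟩

lemma bsp_p1 {x : ℝ} (h0 : 0 ≤ x) (h1 : x ≤ 1) : bsp x = 2/3 - x^2 + x^3/2 := by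
  unfold bsp phi
  rw [abs_of_nonneg h0, if_pos (by linarith)]; ring

lemma bsp_p2 {x : ℝ} (h0 : 1 ≤ x) (h1 : x ≤ 2) : bsp x = (2-x)^3/6 := by
  rcases eq_or_lt_of_le h0 with h | h
  · rw [bsp_p1 (by linarith) h.symm.le, ← h]; norm_num
  unfold bsp phi
  rw [abs_of_nonneg (by linarith), if_neg (by linarith), if_pos (by linarith)]; ring

lemma bsp_integrable : Integrable bsp := bsp_continuous.integrable_of_hasCompactSupport bsp_compact

/-- antiderivative of a cubic times an exponential -/
lemma cubic_exp_integral (p0 p1 p2 p3 a : ℂ) (ha : a ≠ 0) (α β : ℝ) :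
    ∫ x in α..β, (p0 + p1 * x + p2 * x^2 + p3 * x^3) * Complex.exp (a * x) =
      (Complex.exp (a * β) * ((p0 + p1 * β + p2 * β^2 + p3 * β^3) / a
        - (p1 + 2 * p2 * β + 3 * p3 * β^2) / a^2 + (2 * p2 + 6 * p3 * β) / a^3 - 6 * p3 / a^4)) -
      (Complex.exp (a * α) * ((p0 + p1 * α + p2 * α^2 + p3 * α^3) / a
        - (p1 + 2 * p2 * α + 3 * p3 * α^2) / a^2 + (2 * p2 + 6 * p3 * α) / a^3 - 6 * p3 / a^4)) := by
  set F : ℂ → ℂ := fun z => Complex.exp (a * z) * ((p0 + p1 * z + p2 * z^2 + p3 * z^3) / a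
        - (p1 + 2 * p2 * z + 3 * p3 * z^2) / a^2 + (2 * p2 + 6 * p3 * z) / a^3 - 6 * p3 / a^4) with hF
  have hd : ∀ z : ℂ, HasDerivAt F ((p0 + p1 * z + p2 * z^2 + p3 * z^3) * Complex.exp (a * z)) z := by
    intro z
    have e1 : HasDerivAt (fun z : ℂ => Complex.exp (a * z)) (Complex.exp (a * z) * (a * 1)) z :=
      ((hasDerivAt_id z).const_mul a).cexp
    have x1 : HasDerivAt (fun z : ℂ => z) 1 z := hasDerivAt_id z
    have x2 : HasDerivAt (fun z : ℂ => z^2) (2 * z) z := by simpa using hasDerivAt_pow 2 z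
    have x3 : HasDerivAt (fun z : ℂ => z^3) (3 * z^2) z := by simpa using hasDerivAt_pow 3 z
    have q0 := ((((hasDerivAt_const z p0).add (x1.const_mul p1)).add (x2.const_mul p2)).add
      (x3.const_mul p3)).div_const a
    have q1 := (((hasDerivAt_const z p1).add (x1.const_mul (2 * p2))).add
      (x2.const_mul (3 * p3))).div_const (a^2)
    have q2 := ((hasDerivAt_const z (2 * p2)).add (x1.const_mul (6 * p3))).div_const (a^3)
    have q := e1.mul (((q0.sub q1).add q2).sub (hasDerivAt_const z (6 * p3 / a^4)))
    refine (q.congr_deriv ?_)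
    simp only [Pi.sub_apply, Pi.add_apply]
    field_simp
    ring
  exact intervalIntegral.integral_eq_sub_of_hasDerivAt (f := fun x : ℝ => F x)
    (fun x _ => (hd x).comp_ofReal) (Continuous.intervalIntegrable (by fun_prop) _ _)

/-- The Fourier transform of the spline. -/
def Wt (ξ : ℝ) : ℝ := (sinc (π * ξ))^4

lemma Wt_continuous : Continuous Wt := by
  unfold Wt
  exact (continuous_sinc.comp (by fun_prop)).pow 4

lemma Wt_nonneg (ξ : ℝ) : 0 ≤ Wt ξ := by unfold Wt; positivity

lemma sinc_sq_le_one (x : ℝ) : (sinc x)^2 ≤ 1 := by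
  rw [← sq_abs]; exact pow_le_one₀ (abs_nonneg _) (abs_sinc_le_one x)

lemma Wt_le_one (ξ : ℝ) : Wt ξ ≤ 1 := by
  unfold Wt
  nlinarith [sinc_sq_le_one (π * ξ), sq_nonneg (sinc (π * ξ))]

lemma Wt_integrable : Integrable Wt := by
  refine Integrable.mono' (integrable_inv_one_add_sq.const_mul 2)
    Wt_continuous.aestronglyMeasurable (Filter.Eventually.of_forall fun ξ => ?_)
  rw [Real.norm_eq_abs, abs_of_nonneg (Wt_nonneg ξ), ← div_eq_mul_inv, le_div_iff₀ (by positivity)]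
  have h1 := Wt_le_one ξ
  have h2 : Wt ξ * ξ^2 ≤ 1 := by
    unfold Wt
    by_cases h : ξ = 0
    · simp [h]
    have hp := Real.pi_gt_three
    have h3 := sinc_sq_le_one (π * ξ)
    have h4 : (sinc (π * ξ))^2 * (π * ξ)^2 ≤ 1 := by
      rw [sinc_of_ne_zero (by positivity), div_pow, div_mul_cancel₀ _ (by positivity)]
      exact sin_sq_le_one _
    have h5 : (sinc (π * ξ))^2 * ξ^2 ≤ 1 := by
      refine le_trans ?_ h4
      gcongr ?_ * ?_
      rw [mul_pow]
      have h6 : 1 ≤ π^2 := by nlinarith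
      exact le_mul_of_one_le_left (sq_nonneg ξ) h6
    calc (sinc (π * ξ))^4 * ξ^2 = (sinc (π * ξ))^2 * ((sinc (π * ξ))^2 * ξ^2) := by ring
      _ ≤ 1 * 1 := by gcongr
      _ = 1 := by ring
  nlinarith

lemma bsp_fourier_ne {ξ : ℝ} (hξ : ξ ≠ 0) :
    𝓕 (fun x => (bsp x : ℂ)) ξ = (Wt ξ : ℂ) := by
  have hpi : (π : ℂ) ≠ 0 := by exact_mod_cast Real.pi_ne_zero
  have hξc : (ξ : ℂ) ≠ 0 := by exact_mod_cast hξ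
  set a : ℂ := -2 * π * ξ * Complex.I with ha
  have ha0 : a ≠ 0 := by simp [ha, hpi, hξc]
  have h0 : 𝓕 (fun x => (bsp x : ℂ)) ξ = ∫ x : ℝ, (bsp x : ℂ) * Complex.exp (a * x) := by
    rw [fourier_real_eq_integral_exp_smul]
    congr 1; ext x
    rw [smul_eq_mul, mul_comm, ha]; congr 2; push_cast; ring
  have hc : Continuous (fun x : ℝ => (bsp x : ℂ) * Complex.exp (a * x)) := by
    have := bsp_continuous
    fun_prop
  have hsupp : ∫ x : ℝ, (bsp x : ℂ) * Complex.exp (a * x) =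
      ∫ x in (-2:ℝ)..2, (bsp x : ℂ) * Complex.exp (a * x) := by
    rw [intervalIntegral.integral_of_le (by norm_num)]
    symm
    apply setIntegral_eq_integral_of_forall_compl_eq_zero
    intro x hx
    rw [bsp_zero, Complex.ofReal_zero, zero_mul]
    by_contra h
    push Not at h
    rw [abs_lt] at h
    exact hx ⟨h.1, h.2.le⟩
  have hii : ∀ u v : ℝ, IntervalIntegrable (fun x : ℝ => (bsp x : ℂ) * Complex.exp (a * x))
      volume u v := fun u v => hc.intervalIntegrable u v
  have hsplit : ∫ x in (-2:ℝ)..2, (bsp x : ℂ) * Complex.exp (a * x) =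
      (∫ x in (-2:ℝ)..(-1:ℝ), (bsp x : ℂ) * Complex.exp (a * x)) +
      (∫ x in (-1:ℝ)..(0:ℝ), (bsp x : ℂ) * Complex.exp (a * x)) +
      (∫ x in (0:ℝ)..(1:ℝ), (bsp x : ℂ) * Complex.exp (a * x)) +
      (∫ x in (1:ℝ)..(2:ℝ), (bsp x : ℂ) * Complex.exp (a * x)) := by
    rw [intervalIntegral.integral_add_adjacent_intervals (hii _ _) (hii _ _),
      intervalIntegral.integral_add_adjacent_intervals (hii _ _) (hii _ _),
      intervalIntegral.integral_add_adjacent_intervals (hii _ _) (hii _ _)]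
  have i1 : (∫ x in (-2:ℝ)..(-1:ℝ), (bsp x : ℂ) * Complex.exp (a * x)) =
      ∫ x in (-2:ℝ)..(-1:ℝ), ((4/3:ℂ) + 2 * x + 1 * x^2 + (1/6) * x^3) * Complex.exp (a * x) := by
    apply intervalIntegral.integral_congr
    intro x hx
    rw [Set.uIcc_of_le (by norm_num)] at hx
    have : bsp x = 4/3 + 2 * x + 1 * x^2 + (1/6) * x^3 := by
      rw [← bsp_neg, bsp_p2 (by linarith [hx.2]) (by linarith [hx.1])]; ring
    simp only [this]; push_cast; ring
  have i2 : (∫ x in (-1:ℝ)..(0:ℝ), (bsp x : ℂ) * Complex.exp (a * x)) =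
      ∫ x in (-1:ℝ)..(0:ℝ), ((2/3:ℂ) + 0 * x + (-1) * x^2 + (-1/2) * x^3) * Complex.exp (a * x) := by
    apply intervalIntegral.integral_congr
    intro x hx
    rw [Set.uIcc_of_le (by norm_num)] at hx
    have : bsp x = 2/3 + 0 * x + (-1) * x^2 + (-1/2) * x^3 := by
      rw [← bsp_neg, bsp_p1 (by linarith [hx.2]) (by linarith [hx.1])]; ring
    simp only [this]; push_cast; ring
  have i3 : (∫ x in (0:ℝ)..(1:ℝ), (bsp x : ℂ) * Complex.exp (a * x)) =
      ∫ x in (0:ℝ)..(1:ℝ), ((2/3:ℂ) + 0 * x + (-1) * x^2 + (1/2) * x^3) * Complex.exp (a * x) := by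
    apply intervalIntegral.integral_congr
    intro x hx
    rw [Set.uIcc_of_le (by norm_num)] at hx
    have : bsp x = 2/3 + 0 * x + (-1) * x^2 + (1/2) * x^3 := by
      rw [bsp_p1 (by linarith [hx.1]) (by linarith [hx.2])]; ring
    simp only [this]; push_cast; ring
  have i4 : (∫ x in (1:ℝ)..(2:ℝ), (bsp x : ℂ) * Complex.exp (a * x)) =
      ∫ x in (1:ℝ)..(2:ℝ), ((4/3:ℂ) + (-2) * x + 1 * x^2 + (-1/6) * x^3) * Complex.exp (a * x) := by
    apply intervalIntegral.integral_congr
    intro x hx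
    rw [Set.uIcc_of_le (by norm_num)] at hx
    have : bsp x = 4/3 + (-2) * x + 1 * x^2 + (-1/6) * x^3 := by
      rw [bsp_p2 (by linarith [hx.1]) (by linarith [hx.2])]; ring
    simp only [this]; push_cast; ring
  rw [h0, hsupp, hsplit, i1, i2, i3, i4]
  simp only [cubic_exp_integral _ _ _ _ a ha0]
  set u : ℂ := Complex.exp (a / 2) with hu
  set v : ℂ := Complex.exp (-a / 2) with hv
  have huv : u * v = 1 := by
    rw [hu, hv, ← Complex.exp_add]; simp [neg_div]
  have e1 : Complex.exp (a * ((-2:ℝ):ℂ)) = v^4 := by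
    rw [hv, ← Complex.exp_nat_mul]; congr 1; push_cast; ring
  have e2 : Complex.exp (a * ((-1:ℝ):ℂ)) = v^2 := by
    rw [hv, ← Complex.exp_nat_mul]; congr 1; push_cast; ring
  have e3 : Complex.exp (a * ((1:ℝ):ℂ)) = u^2 := by
    rw [hu, ← Complex.exp_nat_mul]; congr 1; push_cast; ring
  have e4 : Complex.exp (a * ((2:ℝ):ℂ)) = u^4 := by
    rw [hu, ← Complex.exp_nat_mul]; congr 1; push_cast; ring
  have e5 : Complex.exp (a * ((0:ℝ):ℂ)) = 1 := by simp
  rw [e1, e2, e3, e4, e5]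
  have hW : (Wt ξ : ℂ) = ((u - v) / a)^4 := by
    unfold Wt
    rw [sinc_of_ne_zero (by positivity)]
    push_cast
    congr 1
    have huv2 : u - v = -2 * Complex.I * Complex.sin (π * ξ) := by
      rw [Complex.sin, hu, hv, ha]
      have A : -2 * (π:ℂ) * ξ * Complex.I / 2 = -(π * ξ) * Complex.I := by ring
      have B : -(-2 * (π:ℂ) * ξ * Complex.I) / 2 = (π * ξ) * Complex.I := by ring
      rw [A, B]
      linear_combination (Complex.exp (-(π * ξ) * Complex.I) - Complex.exp (π * ξ * Complex.I)) * Complex.I_sq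
    rw [huv2, ha]
    field_simp
  rw [hW, div_pow]
  have key : (u - v)^4 = u^4 - 4 * u^2 + 6 - 4 * v^2 + v^4 := by
    linear_combination (-4 * u^2 - 4 * v^2 + 6 * (u * v + 1)) * huv
  rw [key]
  field_simp
  push_cast
  ring

lemma bsp_fourier (ξ : ℝ) : 𝓕 (fun x => (bsp x : ℂ)) ξ = (Wt ξ : ℂ) := by
  have h1 : Continuous (𝓕 (fun x => (bsp x : ℂ))) := by
    exact VectorFourier.fourierIntegral_continuous Real.continuous_fourierChar
      (by exact continuous_inner) bsp_integrable.ofReal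
  have h2 : Continuous (fun ξ => (Wt ξ : ℂ)) := by
    have := Wt_continuous
    fun_prop
  have := Continuous.ext_on (dense_compl_singleton (0:ℝ)) h1 h2
    (fun x hx => bsp_fourier_ne hx)
  exact congrFun this ξ

lemma bsp_rep (t : ℝ) :
    (bsp t : ℂ) = ∫ ξ : ℝ, (Wt ξ : ℂ) * Complex.exp (2 * π * ξ * t * Complex.I) := by
  have hF : 𝓕 (fun x => (bsp x : ℂ)) = fun ξ => (Wt ξ : ℂ) := funext bsp_fourier
  have h := MeasureTheory.Integrable.fourierInv_fourier_eq (f := fun x => (bsp x : ℂ)) (v := t)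
    bsp_integrable.ofReal (by rw [hF]; exact Wt_integrable.ofReal)
    (by have := bsp_continuous; fun_prop)
  rw [hF, Real.fourierInv_eq'] at h
  rw [← h]
  congr 1; ext ξ
  rw [smul_eq_mul, mul_comm]; congr 2
  simp; ring

lemma bsp_rep_int (ξ : ℝ) :
    (Wt ξ : ℂ) = ∫ x : ℝ, (bsp x : ℂ) * Complex.exp (- (2 * π * ξ * x * Complex.I)) := by
  rw [← bsp_fourier, fourier_real_eq_integral_exp_smul]
  congr 1; ext x
  rw [smul_eq_mul, mul_comm]; congr 2; push_cast; ring

/-- Autocorrelation of the spline. -/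
def Gt (t : ℝ) : ℝ := ∫ x : ℝ, bsp x * bsp (t + x)

lemma norm_exp_I (x : ℂ) (r : ℝ) (h : x = r * Complex.I) : ‖Complex.exp x‖ = 1 := by
  rw [h, Complex.norm_exp_ofReal_mul_I]

lemma Gt_rep (t : ℝ) :
    (Gt t : ℂ) = ∫ ξ : ℝ, ((Wt ξ)^2 : ℝ) * Complex.exp (2 * π * ξ * t * Complex.I) := by
  unfold Gt
  rw [← integral_complex_ofReal]
  have h1 : ∀ x : ℝ, ((bsp x * bsp (t + x) : ℝ) : ℂ) = ∫ ξ : ℝ, (bsp x : ℂ) *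
      ((Wt ξ : ℂ) * Complex.exp (2 * π * ξ * (t + x) * Complex.I)) := by
    intro x
    rw [integral_const_mul]
    have := bsp_rep (t + x)
    push_cast at this ⊢
    rw [this]
  simp_rw [h1]
  rw [integral_integral_swap]
  · congr 1; ext ξ
    have h2 : (Wt ξ : ℂ) = ∫ x : ℝ, (bsp x : ℂ) * Complex.exp (2 * π * ξ * x * Complex.I) := by
      have h3 := bsp_rep_int (-ξ)
      have h4 : Wt (-ξ) = Wt ξ := by simp [Wt, sinc_neg]
      rw [h4] at h3
      rw [h3]; congr 1; ext x; congr 2; push_cast; ring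
    have h5 : (((Wt ξ)^2 : ℝ) : ℂ) * Complex.exp (2 * π * ξ * t * Complex.I) =
        ((Wt ξ : ℂ) * Complex.exp (2 * π * ξ * t * Complex.I)) * (Wt ξ : ℂ) := by
      push_cast; ring
    rw [h5]
    nth_rw 3 [h2]
    rw [← integral_const_mul]
    congr 1; ext x
    have : (2 * π * ξ * (t + x) * Complex.I : ℂ) =
      2 * π * ξ * t * Complex.I + 2 * π * ξ * x * Complex.I := by ring
    rw [this, Complex.exp_add]; ring
  · have hi : Integrable (fun z : ℝ × ℝ => (bsp z.1 : ℂ) * (Wt z.2 : ℂ)) (volume.prod volume) :=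
      bsp_integrable.ofReal.mul_prod Wt_integrable.ofReal
    have := hi.bdd_mul (f := fun z : ℝ × ℝ => Complex.exp (2 * π * z.2 * (t + z.1) * Complex.I))
      (c := 1) (Continuous.aestronglyMeasurable (by fun_prop))
      (Filter.Eventually.of_forall fun z => by
        rw [norm_exp_I _ (2 * π * z.2 * (t + z.1)) (by push_cast; ring)])
    refine this.congr (Filter.Eventually.of_forall fun z => ?_)
    simp only [Function.uncurry]
    ring

lemma Wt_sq_integrable : Integrable (fun ξ => (Wt ξ)^2) := by
  have := Wt_continuous
  refine Wt_integrable.mono' (Continuous.aestronglyMeasurable (by fun_prop))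
    (Filter.Eventually.of_forall fun ξ => ?_)
  rw [Real.norm_eq_abs, abs_of_nonneg (by positivity)]
  nlinarith [Wt_nonneg ξ, Wt_le_one ξ]

lemma Gt_zero {t : ℝ} (h : 4 ≤ |t|) : Gt t = 0 := by
  unfold Gt
  rw [← integral_zero ℝ ℝ]
  congr 1; ext x
  by_cases hx : 2 ≤ |x|
  · rw [bsp_zero hx, zero_mul]
  · rw [bsp_zero (x := t + x), mul_zero]
    push Not at hx
    have := abs_sub_abs_le_abs_sub t (-x)
    rw [sub_neg_eq_add, abs_neg] at this
    linarith

lemma Gt_bound : ∃ K : ℝ, 0 ≤ K ∧ ∀ t, |Gt t| ≤ K := by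
  refine ⟨∫ ξ, (Wt ξ)^2, integral_nonneg fun _ => sq_nonneg _, fun t => ?_⟩
  rw [← Real.norm_eq_abs, ← Complex.norm_real, Gt_rep]
  refine (norm_integral_le_integral_norm _).trans (le_of_eq ?_)
  congr 1; ext ξ
  rw [norm_mul, norm_exp_I _ (2 * π * ξ * t) (by push_cast; ring), mul_one, Complex.norm_real,
    Real.norm_eq_abs, abs_of_nonneg (sq_nonneg _)]

/-- The indicator of the unit box. -/
def Wi (ξ : ℝ) : ℝ := Set.indicator (Set.Icc (-1/2 : ℝ) (1/2)) (fun _ => (1:ℝ)) ξ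

lemma Wi_integrable : Integrable Wi := by
  unfold Wi
  exact (integrable_indicator_iff measurableSet_Icc).2 (by simp)

lemma Wi_rep (t : ℝ) :
    (sinc (π * t) : ℂ) = ∫ ξ : ℝ, (Wi ξ : ℂ) * Complex.exp (2 * π * ξ * t * Complex.I) := by
  have h1 : ∀ ξ : ℝ, (Wi ξ : ℂ) * Complex.exp (2 * π * ξ * t * Complex.I) =
      Set.indicator (Set.Icc (-1/2 : ℝ) (1/2))
        (fun ξ : ℝ => Complex.exp ((2 * π * t * Complex.I) * ξ)) ξ := by
    intro ξ
    unfold Wi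
    by_cases h : ξ ∈ Set.Icc (-1/2 : ℝ) (1/2)
    · rw [Set.indicator_of_mem h, Set.indicator_of_mem h]
      rw [Complex.ofReal_one, one_mul]; congr 1; ring
    · rw [Set.indicator_of_notMem h, Set.indicator_of_notMem h]; simp
  simp_rw [h1]
  rw [integral_indicator measurableSet_Icc, integral_Icc_eq_integral_Ioc,
    ← intervalIntegral.integral_of_le (by norm_num)]
  by_cases ht : t = 0
  · simp [ht]; norm_num
  have hpi : (π : ℂ) ≠ 0 := by exact_mod_cast Real.pi_ne_zero
  have htc : (t : ℂ) ≠ 0 := by exact_mod_cast ht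
  rw [integral_exp_mul_complex (by simp [hpi, htc]), sinc_of_ne_zero (by positivity)]
  push_cast
  rw [Complex.sin]
  have A : 2 * (π:ℂ) * t * Complex.I * (1/2) = (π * t) * Complex.I := by ring
  have B : 2 * (π:ℂ) * t * Complex.I * (-1/2) = -(π * t) * Complex.I := by ring
  rw [A, B, neg_mul]
  field_simp
  linear_combination (Complex.exp (-(π * t * Complex.I)) - Complex.exp (π * t * Complex.I)) * Complex.I_sq

lemma Wt_lower (ξ : ℝ) : (2/π)^4 * Wi ξ ≤ Wt ξ := by
  unfold Wi
  by_cases h : ξ ∈ Set.Icc (-1/2 : ℝ) (1/2)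
  · rw [Set.indicator_of_mem h, mul_one]
    unfold Wt
    have hp := Real.pi_pos
    have hs : ∀ x : ℝ, 0 ≤ x → x ≤ π / 2 → 2/π ≤ sinc x := by
      intro x hx hx2
      rcases eq_or_lt_of_le hx with h0 | h0
      · rw [← h0, sinc_zero, div_le_one hp]; linarith [Real.two_le_pi]
      · rw [sinc_of_ne_zero h0.ne', le_div_iff₀ h0]; exact mul_le_sin hx hx2
    have h2 : 2/π ≤ sinc (π * ξ) := by
      rcases le_total 0 ξ with h0 | h0
      · exact hs _ (by positivity) (by nlinarith [h.2])
      · rw [← sinc_neg]; exact hs _ (by nlinarith) (by nlinarith [h.1])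
    gcongr
  · rw [Set.indicator_of_notMem h, mul_zero]; exact Wt_nonneg ξ

/-- Trigonometric polynomial of a finite sequence. -/
def Cf {d : ℕ} (S : Finset (Fin d → ℤ)) (c : (Fin d → ℤ) → ℝ) (η : Fin d → ℝ) : ℂ :=
  ∑ k ∈ S, (c k : ℂ) * ∏ j, Complex.exp (2 * π * η j * (k j) * Complex.I)

/-- Squared modulus of the trigonometric polynomial. -/
def Pf {d : ℕ} (S : Finset (Fin d → ℤ)) (c : (Fin d → ℤ) → ℝ) (η : Fin d → ℝ) : ℝ :=
  Complex.normSq (Cf S c η)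

lemma Pf_nonneg {d : ℕ} (S : Finset (Fin d → ℤ)) (c : (Fin d → ℤ) → ℝ) (η : Fin d → ℝ) :
    0 ≤ Pf S c η := Complex.normSq_nonneg _

lemma Pf_continuous {d : ℕ} (S : Finset (Fin d → ℤ)) (c : (Fin d → ℤ) → ℝ) :
    Continuous (Pf S c) := by
  unfold Pf Cf
  exact Complex.continuous_normSq.comp (by fun_prop)

lemma Pf_bound {d : ℕ} (S : Finset (Fin d → ℤ)) (c : (Fin d → ℤ) → ℝ) (η : Fin d → ℝ) :
    Pf S c η ≤ (∑ k ∈ S, |c k|)^2 := by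
  unfold Pf
  rw [Complex.normSq_eq_norm_sq]
  gcongr
  unfold Cf
  refine (norm_sum_le _ _).trans (Finset.sum_le_sum fun k _ => ?_)
  rw [norm_mul, norm_prod, Finset.prod_eq_one, mul_one, Complex.norm_real, Real.norm_eq_abs]
  intro j _
  exact norm_exp_I _ (2 * π * η j * k j) (by push_cast; ring)

lemma Pf_eq {d : ℕ} (S : Finset (Fin d → ℤ)) (c : (Fin d → ℤ) → ℝ) (η : Fin d → ℝ) :
    (Pf S c η : ℂ) = ∑ k ∈ S, ∑ m ∈ S, (c k : ℂ) * (c m : ℂ) *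
      ∏ j, Complex.exp (2 * π * η j * ((k j : ℂ) - (m j : ℂ)) * Complex.I) := by
  unfold Pf
  rw [← Complex.mul_conj]
  unfold Cf
  rw [map_sum, Finset.sum_mul_sum]
  refine Finset.sum_congr rfl fun k _ => Finset.sum_congr rfl fun m _ => ?_
  rw [map_mul, map_prod, Complex.conj_ofReal, mul_mul_mul_comm, ← Finset.prod_mul_distrib]
  congr 1
  refine Finset.prod_congr rfl fun j _ => ?_
  rw [← Complex.exp_conj, ← Complex.exp_add]
  congr 1
  have h2 : (starRingEnd ℂ) 2 = 2 := Complex.conj_ofNat 2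
  simp [h2]
  ring

lemma quad_integrable {d : ℕ} (W : ℝ → ℝ) (hW : Integrable W)
    (S : Finset (Fin d → ℤ)) (c : (Fin d → ℤ) → ℝ) (f : (Fin d → ℝ) → ℝ) (hf : Continuous f)
    (K : ℝ) (hK : ∀ η, |f η| ≤ K) :
    Integrable (fun η : Fin d → ℝ => (∏ j, W (η j)) * Pf S c η * f η) := by
  have h1 : Integrable (fun η : Fin d → ℝ => ∏ j, W (η j)) :=
    Integrable.fintype_prod (fun _ => hW)
  have hP := Pf_continuous S c
  have h2 := h1.bdd_mul (f := fun η => Pf S c η * f η) (c := (∑ k ∈ S, |c k|)^2 * K)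
    (Continuous.aestronglyMeasurable (by fun_prop)) (Filter.Eventually.of_forall fun η => by
      rw [norm_mul, Real.norm_eq_abs, Real.norm_eq_abs, abs_of_nonneg (Pf_nonneg S c η)]
      have := Pf_bound S c η
      gcongr
      exact hK η)
  refine h2.congr (Filter.Eventually.of_forall fun η => ?_)
  simp only
  ring

lemma quad_rep {d : ℕ} (W : ℝ → ℝ) (hW : Integrable W) (g : ℝ → ℝ)
    (hg : ∀ t : ℝ, (g t : ℂ) = ∫ ξ : ℝ, (W ξ : ℂ) * Complex.exp (2 * π * ξ * t * Complex.I))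
    (S : Finset (Fin d → ℤ)) (c : (Fin d → ℤ) → ℝ) (t : Fin d → ℝ) :
    ∑ k ∈ S, ∑ m ∈ S, c k * c m * ∏ j, g ((k j : ℝ) - (m j : ℝ) + t j) =
      ∫ η : Fin d → ℝ, (∏ j, W (η j)) * Pf S c η * Real.cos (2 * π * ∑ j, η j * t j) := by
  have hint1 : ∀ a : ℝ, Integrable (fun ξ : ℝ => (W ξ : ℂ) * Complex.exp (2 * π * ξ * a * Complex.I)) := by
    intro a
    have := hW.ofReal (𝕜 := ℂ) |>.bdd_mul
      (f := fun ξ : ℝ => Complex.exp (2 * π * ξ * a * Complex.I)) (c := 1)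
      (Continuous.aestronglyMeasurable (by fun_prop)) (Filter.Eventually.of_forall fun ξ => by
        rw [norm_exp_I _ (2 * π * ξ * a) (by push_cast; ring)])
    refine this.congr (Filter.Eventually.of_forall fun ξ => ?_)
    exact mul_comm _ _
  have hint2 : ∀ k m : Fin d → ℤ, Integrable (fun η : Fin d → ℝ =>
      ((c k : ℂ) * (c m : ℂ)) * ∏ j, ((W (η j) : ℂ) *
        Complex.exp (2 * π * (η j : ℝ) * (((k j : ℝ) - (m j : ℝ) + t j : ℝ) : ℂ) * Complex.I))) := by
    intro k m
    exact (Integrable.fintype_prod (fun j => hint1 ((k j : ℝ) - (m j : ℝ) + t j))).const_mul _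
  have key : ((∑ k ∈ S, ∑ m ∈ S, c k * c m * ∏ j, g ((k j : ℝ) - (m j : ℝ) + t j) : ℝ) : ℂ) =
      ∫ η : Fin d → ℝ, (((∏ j, W (η j)) * Pf S c η : ℝ) : ℂ) *
        Complex.exp ((2 * π * ∑ j, η j * t j : ℝ) * Complex.I) := by
    have step : ∀ k m : Fin d → ℤ, ((c k * c m * ∏ j, g ((k j : ℝ) - (m j : ℝ) + t j) : ℝ) : ℂ) =
        ∫ η : Fin d → ℝ, ((c k : ℂ) * (c m : ℂ)) * ∏ j, ((W (η j) : ℂ) *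
        Complex.exp (2 * π * (η j : ℝ) * (((k j : ℝ) - (m j : ℝ) + t j : ℝ) : ℂ) * Complex.I)) := by
      intro k m
      rw [integral_const_mul, integral_fintype_prod_volume_eq_prod (fun (j : Fin d) (ξ : ℝ) =>
        (W ξ : ℂ) * Complex.exp (2 * π * (ξ : ℝ) * (((k j : ℝ) - (m j : ℝ) + t j : ℝ) : ℂ) * Complex.I))]
      simp only [← hg]
      rw [Complex.ofReal_mul, Complex.ofReal_mul, Complex.ofReal_prod]
    rw [Complex.ofReal_sum]
    simp_rw [Complex.ofReal_sum, step]
    rw [show (∑ k ∈ S, ∑ m ∈ S, ∫ η : Fin d → ℝ, ((c k : ℂ) * (c m : ℂ)) * ∏ j, ((W (η j) : ℂ) *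
        Complex.exp (2 * π * (η j : ℝ) * (((k j : ℝ) - (m j : ℝ) + t j : ℝ) : ℂ) * Complex.I))) =
        ∑ k ∈ S, ∫ η : Fin d → ℝ, ∑ m ∈ S, ((c k : ℂ) * (c m : ℂ)) * ∏ j, ((W (η j) : ℂ) *
        Complex.exp (2 * π * (η j : ℝ) * (((k j : ℝ) - (m j : ℝ) + t j : ℝ) : ℂ) * Complex.I)) from
        Finset.sum_congr rfl fun k _ => (integral_finsetSum _ fun m _ => hint2 k m).symm]
    rw [← integral_finsetSum _ fun k _ => integrable_finsetSum _ fun m _ => hint2 k m]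
    congr 1; ext η
    rw [Complex.ofReal_mul, Pf_eq, Complex.ofReal_prod, Finset.mul_sum, Finset.sum_mul]
    refine Finset.sum_congr rfl fun k _ => ?_
    rw [Finset.mul_sum, Finset.sum_mul]
    refine Finset.sum_congr rfl fun m _ => ?_
    have hexp : Complex.exp ((2 * π * ∑ j, η j * t j : ℝ) * Complex.I) =
        ∏ j, Complex.exp (2 * π * η j * t j * Complex.I) := by
      rw [← Complex.exp_sum]
      congr 1
      push_cast
      rw [Finset.mul_sum, Finset.sum_mul]
      refine Finset.sum_congr rfl fun j _ => by ring
    rw [hexp, Finset.prod_mul_distrib]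
    have : ∀ j, Complex.exp (2 * π * (η j : ℝ) * (((k j : ℝ) - (m j : ℝ) + t j : ℝ) : ℂ) * Complex.I) =
        Complex.exp (2 * π * η j * ((k j : ℂ) - (m j : ℂ)) * Complex.I) *
        Complex.exp (2 * π * η j * t j * Complex.I) := by
      intro j
      rw [← Complex.exp_add]; congr 1; push_cast; ring
    simp_rw [this, Finset.prod_mul_distrib]
    ring
  have hW' : Integrable (fun η : Fin d → ℝ => (((∏ j, W (η j)) * Pf S c η : ℝ) : ℂ) *
        Complex.exp ((2 * π * ∑ j, η j * t j : ℝ) * Complex.I)) := by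
    have h0 := (quad_integrable W hW S c (fun _ => 1) continuous_const 1 (by simp)).ofReal (𝕜 := ℂ)
    have := h0.bdd_mul (f := fun η : Fin d → ℝ => Complex.exp ((2 * π * ∑ j, η j * t j : ℝ) * Complex.I))
      (c := 1) (Continuous.aestronglyMeasurable (by fun_prop)) (Filter.Eventually.of_forall fun η => by
        rw [norm_exp_I _ _ rfl])
    refine this.congr (Filter.Eventually.of_forall fun η => ?_)
    simp only [mul_one]
    exact mul_comm _ _
  have h2 := congrArg Complex.re key
  rw [Complex.ofReal_re] at h2
  rw [h2]
  have h3 := Complex.reCLM.integral_comp_comm hW'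
  simp only [Complex.reCLM_apply] at h3
  rw [← h3]
  congr 1; ext η
  rw [Complex.re_ofReal_mul, Complex.exp_ofReal_mul_I_re]

lemma sinc_int {n : ℤ} (hn : n ≠ 0) : sinc (π * n) = 0 := by
  have : (n : ℝ) ≠ 0 := by exact_mod_cast hn
  rw [sinc_of_ne_zero (by positivity), mul_comm, Real.sin_int_mul_pi, zero_div]

lemma parseval {d : ℕ} (S : Finset (Fin d → ℤ)) (c : (Fin d → ℤ) → ℝ) :
    ∫ η : Fin d → ℝ, (∏ j, Wi (η j)) * Pf S c η = ∑ k ∈ S, (c k)^2 := by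
  have h := quad_rep Wi Wi_integrable (fun t => sinc (π * t)) Wi_rep S c (fun _ => 0)
  simp only [mul_zero, Finset.sum_const_zero, Real.cos_zero, mul_one, add_zero] at h
  rw [← h]
  refine Finset.sum_congr rfl fun k hk => ?_
  rw [Finset.sum_eq_single_of_mem k hk]
  · simp [sq]
  · intro m _ hm
    obtain ⟨j, hj⟩ : ∃ j, k j ≠ m j := by
      by_contra hcon
      push Not at hcon
      exact hm (funext fun j => (hcon j).symm)
    rw [Finset.prod_eq_zero (Finset.mem_univ j), mul_zero]
    have := sinc_int (sub_ne_zero.2 hj)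
    push_cast at this
    exact this

lemma parseval_shift {d : ℕ} (S : Finset (Fin d → ℤ)) (c : (Fin d → ℤ) → ℝ) (j₀ : Fin d) (N : ℕ)
    (hN : ∀ k ∈ S, ∀ m ∈ S, k j₀ - m j₀ + N ≠ 0) :
    ∫ η : Fin d → ℝ, (∏ j, Wi (η j)) * Pf S c η * Real.cos (2 * π * (η j₀ * N)) = 0 := by
  have h := quad_rep Wi Wi_integrable (fun t => sinc (π * t)) Wi_rep S c (Pi.single j₀ (N : ℝ))
  have h2 : ∀ η : Fin d → ℝ, ∑ j, η j * (Pi.single j₀ (N : ℝ) : Fin d → ℝ) j = η j₀ * N := by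
    intro η
    rw [Finset.sum_eq_single_of_mem j₀ (Finset.mem_univ _)]
    · simp
    · intro j _ hj; simp [hj]
  simp only [h2] at h
  rw [← h]
  refine Finset.sum_eq_zero fun k hk => Finset.sum_eq_zero fun m hm => ?_
  rw [Finset.prod_eq_zero (Finset.mem_univ j₀), mul_zero]
  have := sinc_int (hN k hk m hm)
  push_cast at this
  simpa using this

lemma prod_W_lower {d : ℕ} (W : ℝ → ℝ) (a : ℝ) (ha : 0 ≤ a) (hW : ∀ ξ, a * Wi ξ ≤ W ξ)
    (η : Fin d → ℝ) : a^d * ∏ j, Wi (η j) ≤ ∏ j, W (η j) := by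
  have h0 : ∀ ξ, 0 ≤ Wi ξ := fun ξ => Set.indicator_nonneg (fun _ _ => zero_le_one) ξ
  calc a^d * ∏ j, Wi (η j) = ∏ j, (a * Wi (η j)) := by
        rw [Finset.prod_mul_distrib]; simp
    _ ≤ ∏ j, W (η j) := Finset.prod_le_prod (fun j _ => mul_nonneg ha (h0 _)) (fun j _ => hW _)

lemma Wi_nonneg (ξ : ℝ) : 0 ≤ Wi ξ := Set.indicator_nonneg (fun _ _ => zero_le_one) ξ

lemma prod_Wi_zero {d : ℕ} (η : Fin d → ℝ) (h : ¬ ∀ j, |η j| ≤ 1/2) : ∏ j, Wi (η j) = 0 := by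
  push Not at h
  obtain ⟨j, hj⟩ := h
  refine Finset.prod_eq_zero (Finset.mem_univ j) ?_
  unfold Wi
  apply Set.indicator_of_notMem
  intro hm
  have : |η j| ≤ 1/2 := abs_le.2 ⟨by linarith [hm.1], hm.2⟩
  linarith

lemma gram_lower {d : ℕ} (S : Finset (Fin d → ℤ)) (c : (Fin d → ℤ) → ℝ) :
    (((2/π)^4)^2)^d * ∑ k ∈ S, (c k)^2 ≤
      ∑ k ∈ S, ∑ m ∈ S, c k * c m * ∏ j, Gt ((k j : ℝ) - (m j : ℝ)) := by
  have h := quad_rep (fun ξ => (Wt ξ)^2) Wt_sq_integrable Gt Gt_rep S c (fun _ => 0)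
  simp only [mul_zero, Finset.sum_const_zero, Real.cos_zero, mul_one, add_zero] at h
  rw [h, ← parseval, ← integral_const_mul]
  have i1 := quad_integrable (fun ξ => (Wt ξ)^2) Wt_sq_integrable S c (fun _ => 1)
    continuous_const 1 (by simp)
  have i2 := quad_integrable Wi Wi_integrable S c (fun _ => 1)
    continuous_const 1 (by simp)
  simp only [mul_one] at i1 i2
  refine integral_mono (i2.const_mul _) i1 fun η => ?_
  simp only
  rw [← mul_assoc]
  refine mul_le_mul_of_nonneg_right ?_ (Pf_nonneg _ _ _)
  refine prod_W_lower (fun ξ => (Wt ξ)^2) _ (by positivity) (fun ξ => ?_) η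
  have h1 := Wt_lower ξ
  have h2 : Wi ξ = (Wi ξ)^2 := by
    unfold Wi
    by_cases h : ξ ∈ Set.Icc (-1/2 : ℝ) (1/2)
    · rw [Set.indicator_of_mem h]; norm_num
    · rw [Set.indicator_of_notMem h]; norm_num
  rw [h2, ← mul_pow]
  have := Wi_nonneg ξ
  gcongr

lemma gram_upper (d : ℕ) : ∃ K : ℝ, 0 < K ∧ ∀ (S : Finset (Fin d → ℤ)) (c : (Fin d → ℤ) → ℝ),
    ∑ k ∈ S, ∑ m ∈ S, c k * c m * ∏ j, Gt ((k j : ℝ) - (m j : ℝ)) ≤ K * ∑ k ∈ S, (c k)^2 := by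
  obtain ⟨K, hK0, hK⟩ := Gt_bound
  set M : (Fin d → ℤ) → (Fin d → ℤ) → ℝ := fun k m => ∏ j, Gt ((k j : ℝ) - (m j : ℝ)) with hM
  have hMb : ∀ k m, |M k m| ≤ K^d := by
    intro k m
    simp only [hM, Finset.abs_prod]
    refine (Finset.prod_le_prod (fun _ _ => abs_nonneg _) (fun j _ => hK _)).trans ?_
    simp
  have hM0 : ∀ k m, (∃ j, 4 ≤ |k j - m j|) → M k m = 0 := by
    rintro k m ⟨j, hj⟩
    refine Finset.prod_eq_zero (Finset.mem_univ j) (Gt_zero ?_)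
    exact_mod_cast hj
  have row : ∀ (S : Finset (Fin d → ℤ)) k, ∑ m ∈ S, |M k m| ≤ (9:ℝ)^d * K^d := by
    intro S k
    classical
    set T : Finset (Fin d → ℤ) := Fintype.piFinset (fun j => Finset.Icc (k j - 4) (k j + 4)) with hT
    have h1 : ∑ m ∈ S, |M k m| = ∑ m ∈ S.filter (· ∈ T), |M k m| := by
      symm
      apply Finset.sum_filter_of_ne
      intro m _ hne
      by_contra hm
      apply hne
      rw [hM0, abs_zero]
      simp only [hT, Fintype.mem_piFinset, Finset.mem_Icc, not_forall] at hm
      obtain ⟨j, hj⟩ := hm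
      refine ⟨j, ?_⟩
      by_contra h
      push Not at h
      rw [abs_lt] at h
      exact hj ⟨by linarith [h.2], by linarith [h.1]⟩
    rw [h1]
    refine (Finset.sum_le_card_nsmul _ _ (K^d) fun m _ => hMb k m).trans ?_
    rw [nsmul_eq_mul]
    refine mul_le_mul_of_nonneg_right ?_ (by positivity)
    have h2 : (S.filter (· ∈ T)).card ≤ T.card :=
      Finset.card_le_card fun m hm => (Finset.mem_filter.1 hm).2
    have h3 : T.card = 9^d := by
      rw [hT, Fintype.card_piFinset]
      have : ∀ j, (Finset.Icc (k j - 4) (k j + 4)).card = 9 := by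
        intro j; rw [Int.card_Icc]; ring_nf; rfl
      simp [this]
    rw [h3] at h2
    exact_mod_cast h2
  have symM : ∀ k m, |M k m| = |M m k| := by
    intro k m
    simp only [hM, Finset.abs_prod]
    refine Finset.prod_congr rfl fun j _ => ?_
    congr 1
    unfold Gt
    rw [← integral_neg_eq_self]
    have : ∀ x, bsp (-x) * bsp ((k j : ℝ) - m j + -x) = bsp x * bsp ((m j : ℝ) - k j + x) := by
      intro x
      rw [bsp_neg, ← bsp_neg ((k j : ℝ) - m j + -x)]
      congr 2; ring
    simp_rw [this]
  refine ⟨(9:ℝ)^d * K^d + 1, by positivity, fun S c => ?_⟩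
  calc ∑ k ∈ S, ∑ m ∈ S, c k * c m * M k m
      ≤ ∑ k ∈ S, ∑ m ∈ S, ((c k)^2 / 2 * |M k m| + (c m)^2 / 2 * |M m k|) := by
        refine Finset.sum_le_sum fun k _ => Finset.sum_le_sum fun m _ => ?_
        rw [← symM k m, ← add_mul]
        refine (le_abs_self _).trans ?_
        rw [abs_mul]
        refine mul_le_mul_of_nonneg_right ?_ (abs_nonneg _)
        rw [abs_le]
        constructor <;> nlinarith [sq_nonneg (c k + c m), sq_nonneg (c k - c m)]
    _ = ∑ k ∈ S, (c k)^2 * ∑ m ∈ S, |M k m| := by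
        simp_rw [Finset.sum_add_distrib]
        rw [Finset.sum_comm (f := fun k m => (c m)^2 / 2 * |M m k|), ← Finset.sum_add_distrib]
        refine Finset.sum_congr rfl fun k _ => ?_
        rw [← Finset.mul_sum]; ring
    _ ≤ ∑ k ∈ S, (c k)^2 * ((9:ℝ)^d * K^d + 1) := by
        refine Finset.sum_le_sum fun k _ => ?_
        have := row S k
        gcongr
        linarith
    _ = _ := by rw [← Finset.sum_mul, mul_comm]

lemma symbol_lower {d : ℕ} {ι : Type*} (B : Finset ι) (w : ι → ℝ) (t : ι → Fin d → ℝ)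
    (hw : ∀ s ∈ B, 0 ≤ w s) (j₀ : Fin d)
    (hA : ∀ η : Fin d → ℝ, η ≠ 0 → ∃ s ∈ B, 0 < w s ∧ ∑ j, η j * t s j ≠ 0)
    (hBc : ∀ η : Fin d → ℝ, (∀ j, |η j| ≤ 1/2) → η ≠ 0 →
      0 < ∑ s ∈ B, w s * (1 - Real.cos (2 * π * ∑ j, η j * t s j))) :
    ∃ κ : ℝ, 0 < κ ∧ ∀ η : Fin d → ℝ, (∀ j, |η j| ≤ 1/2) →
      κ * (η j₀)^2 ≤ ∑ s ∈ B, w s * (1 - Real.cos (2 * π * ∑ j, η j * t s j)) := by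
  have hq : ∃ m : ℝ, 0 < m ∧ ∀ η : Fin d → ℝ, η ∈ Metric.sphere (0 : Fin d → ℝ) 1 →
      m ≤ ∑ s ∈ B, w s * (∑ j, η j * t s j)^2 := by
    refine (isCompact_sphere (0 : Fin d → ℝ) 1).exists_forall_le' (Continuous.continuousOn (by fun_prop)) ?_
    intro η hη
    obtain ⟨s, hs, hws, hne⟩ := hA η (by rintro rfl; simp at hη)
    refine Finset.sum_pos' (fun s hs => mul_nonneg (hw s hs) (sq_nonneg _)) ⟨s, hs, ?_⟩
    positivity
  obtain ⟨m, hm, hmq⟩ := hq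
  have hq2 : ∀ η : Fin d → ℝ, m * ‖η‖^2 ≤ ∑ s ∈ B, w s * (∑ j, η j * t s j)^2 := by
    intro η
    by_cases h0 : η = 0
    · subst h0; simp
    have hn : 0 < ‖η‖ := norm_pos_iff.2 h0
    have h1 := hmq (‖η‖⁻¹ • η) (by
      rw [mem_sphere_zero_iff_norm, norm_smul, norm_inv, norm_norm, inv_mul_cancel₀ hn.ne'])
    have h2 : ∑ s ∈ B, w s * (∑ j, (‖η‖⁻¹ • η) j * t s j)^2 =
        (‖η‖⁻¹)^2 * ∑ s ∈ B, w s * (∑ j, η j * t s j)^2 := by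
      rw [Finset.mul_sum]
      refine Finset.sum_congr rfl fun s _ => ?_
      simp only [Pi.smul_apply, smul_eq_mul, mul_assoc]
      rw [← Finset.mul_sum]; ring
    rw [h2, inv_pow, ← div_eq_inv_mul, le_div_iff₀ (by positivity)] at h1
    exact h1
  set T : ℝ := 1 + ∑ s ∈ B, ∑ j, |t s j| with hT
  have hT0 : 1 ≤ T := by
    have : 0 ≤ ∑ s ∈ B, ∑ j, |t s j| :=
      Finset.sum_nonneg fun _ _ => Finset.sum_nonneg fun _ _ => abs_nonneg _
    linarith
  have hdot : ∀ s ∈ B, ∀ η : Fin d → ℝ, |∑ j, η j * t s j| ≤ ‖η‖ * T := by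
    intro s hs η
    calc |∑ j, η j * t s j| ≤ ∑ j, |η j * t s j| := Finset.abs_sum_le_sum_abs _ _
      _ ≤ ∑ j, ‖η‖ * |t s j| := by
          refine Finset.sum_le_sum fun j _ => ?_
          rw [abs_mul]
          refine mul_le_mul_of_nonneg_right ?_ (abs_nonneg _)
          exact norm_le_pi_norm η j
      _ = ‖η‖ * ∑ j, |t s j| := by rw [Finset.mul_sum]
      _ ≤ ‖η‖ * T := by
          refine mul_le_mul_of_nonneg_left ?_ (norm_nonneg _)
          have := Finset.single_le_sum (f := fun s => ∑ j, |t s j|)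
            (fun _ _ => Finset.sum_nonneg fun _ _ => abs_nonneg _) hs
          linarith
  set r : ℝ := 1 / (2 * T) with hr
  have hr0 : 0 < r := by positivity
  have hfar : ∃ m₂ : ℝ, 0 < m₂ ∧ ∀ η : Fin d → ℝ,
      η ∈ Metric.closedBall (0 : Fin d → ℝ) (1/2) ∩ {η | r ≤ ‖η‖} →
      m₂ ≤ ∑ s ∈ B, w s * (1 - Real.cos (2 * π * ∑ j, η j * t s j)) := by
    refine ((isCompact_closedBall (0 : Fin d → ℝ) (1/2)).inter_right
      (isClosed_le continuous_const continuous_norm)).exists_forall_le'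
      (Continuous.continuousOn (by fun_prop)) ?_
    rintro η ⟨h1, h2⟩
    refine hBc η (fun j => ?_) ?_
    · rw [mem_closedBall_zero_iff] at h1
      exact (norm_le_pi_norm η j).trans h1
    · rintro rfl
      have h3 : r ≤ ‖(0 : Fin d → ℝ)‖ := h2
      rw [norm_zero] at h3
      linarith
  obtain ⟨m₂, hm₂, hfar⟩ := hfar
  refine ⟨min (8 * m) (4 * m₂), by positivity, fun η hη => ?_⟩
  have hj : |η j₀| ≤ ‖η‖ := norm_le_pi_norm η j₀
  have hj2 : (η j₀)^2 ≤ ‖η‖^2 := by rw [← sq_abs]; gcongr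
  rcases le_total ‖η‖ r with h | h
  · calc min (8 * m) (4 * m₂) * (η j₀)^2 ≤ 8 * m * ‖η‖^2 := by
          gcongr; exact min_le_left _ _
      _ ≤ 8 * ∑ s ∈ B, w s * (∑ j, η j * t s j)^2 := by
          rw [mul_assoc]; gcongr; exact hq2 η
      _ ≤ _ := by
          rw [Finset.mul_sum]
          refine Finset.sum_le_sum fun s hs => ?_
          have h1 := hdot s hs η
          have h2 : ‖η‖ * T ≤ 1/2 := by
            calc ‖η‖ * T ≤ r * T := by gcongr
              _ = 1/2 := by rw [hr]; field_simp
          have hp := Real.pi_pos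
          have h3 := Real.cos_le_one_sub_mul_cos_sq (x := 2 * π * ∑ j, η j * t s j) (by
            rw [abs_mul, abs_of_pos (by positivity)]
            nlinarith)
          have h4 : 2 / π^2 * (2 * π * ∑ j, η j * t s j)^2 = 8 * (∑ j, η j * t s j)^2 := by
            field_simp; ring
          rw [h4] at h3
          have := hw s hs
          nlinarith
  · have h1 := hfar η ⟨by
      rw [mem_closedBall_zero_iff, pi_norm_le_iff_of_nonneg (by norm_num)]
      exact hη, h⟩
    refine le_trans ?_ h1
    have h2 : (η j₀)^2 ≤ 1/4 := by
      rw [← sq_abs]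
      have := hη j₀
      nlinarith [abs_nonneg (η j₀)]
    calc min (8 * m) (4 * m₂) * (η j₀)^2 ≤ 4 * m₂ * (1/4) := by
          gcongr; exact min_le_right _ _
      _ = m₂ := by ring

lemma energy_lower {d : ℕ} {ι : Type*} (B : Finset ι) (w : ι → ℝ) (t : ι → Fin d → ℝ)
    (hw : ∀ s ∈ B, 0 ≤ w s) (j₀ : Fin d)
    (hA : ∀ η : Fin d → ℝ, η ≠ 0 → ∃ s ∈ B, 0 < w s ∧ ∑ j, η j * t s j ≠ 0)
    (hBc : ∀ η : Fin d → ℝ, (∀ j, |η j| ≤ 1/2) → η ≠ 0 →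
      0 < ∑ s ∈ B, w s * (1 - Real.cos (2 * π * ∑ j, η j * t s j))) :
    ∃ κ : ℝ, 0 < κ ∧ ∀ (S : Finset (Fin d → ℤ)) (c : (Fin d → ℤ) → ℝ) (N : ℕ), 0 < N →
      (∀ k ∈ S, ∀ m ∈ S, k j₀ - m j₀ + N ≠ 0) →
      κ / N^2 * ∑ k ∈ S, (c k)^2 ≤
        ∑ s ∈ B, w s * ((∑ k ∈ S, ∑ m ∈ S, c k * c m * ∏ j, bsp ((k j : ℝ) - (m j : ℝ))) -
          (∑ k ∈ S, ∑ m ∈ S, c k * c m * ∏ j, bsp ((k j : ℝ) - (m j : ℝ) + t s j))) := by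
  obtain ⟨κ, hκ, hsym⟩ := symbol_lower B w t hw j₀ hA hBc
  have hp := Real.pi_pos
  refine ⟨((2/π)^4)^d * (κ / (2 * π^2)), by positivity, fun S c N hN hS => ?_⟩
  have hN' : (0:ℝ) < N := by exact_mod_cast hN
  have hcosc : ∀ u : Fin d → ℝ, Continuous fun η : Fin d → ℝ => Real.cos (2 * π * ∑ j, η j * u j) := by
    intro u; fun_prop
  have h0 := quad_rep Wt Wt_integrable bsp bsp_rep S c (fun _ => 0)
  simp only [mul_zero, Finset.sum_const_zero, Real.cos_zero, mul_one, add_zero] at h0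
  have i0 := quad_integrable Wt Wt_integrable S c (fun _ => 1) continuous_const 1 (by simp)
  have j0 := quad_integrable Wi Wi_integrable S c (fun _ => 1) continuous_const 1 (by simp)
  simp only [mul_one] at i0 j0
  have i1 : ∀ s, Integrable (fun η : Fin d → ℝ => (∏ j, Wt (η j)) * Pf S c η *
      Real.cos (2 * π * ∑ j, η j * t s j)) := fun s =>
    quad_integrable Wt Wt_integrable S c _ (hcosc _) 1 (fun η => Real.abs_cos_le_one _)
  have j1 : Integrable (fun η : Fin d → ℝ => (∏ j, Wi (η j)) * Pf S c η *
      Real.cos (2 * π * (η j₀ * N))) :=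
    quad_integrable Wi Wi_integrable S c (fun η => Real.cos (2 * π * (η j₀ * N))) (by fun_prop) 1
      (fun η => Real.abs_cos_le_one _)
  have hR : ∑ s ∈ B, w s * ((∑ k ∈ S, ∑ m ∈ S, c k * c m * ∏ j, bsp ((k j : ℝ) - (m j : ℝ))) -
          (∑ k ∈ S, ∑ m ∈ S, c k * c m * ∏ j, bsp ((k j : ℝ) - (m j : ℝ) + t s j))) =
      ∫ η : Fin d → ℝ, ∑ s ∈ B, w s * ((∏ j, Wt (η j)) * Pf S c η -
        (∏ j, Wt (η j)) * Pf S c η * Real.cos (2 * π * ∑ j, η j * t s j)) := by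
    have i2 : ∀ s ∈ B, Integrable (fun η : Fin d → ℝ => w s * ((∏ j, Wt (η j)) * Pf S c η -
        (∏ j, Wt (η j)) * Pf S c η * Real.cos (2 * π * ∑ j, η j * t s j))) :=
      fun s _ => (i0.sub (i1 s)).const_mul (w s)
    rw [integral_finsetSum _ i2]
    refine Finset.sum_congr rfl fun s _ => ?_
    rw [integral_const_mul, integral_sub i0 (i1 s), h0,
      quad_rep Wt Wt_integrable bsp bsp_rep S c (t s)]
  have hL : ∑ k ∈ S, (c k)^2 = ∫ η : Fin d → ℝ, ((∏ j, Wi (η j)) * Pf S c η -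
      (∏ j, Wi (η j)) * Pf S c η * Real.cos (2 * π * (η j₀ * N))) := by
    rw [integral_sub j0 j1, parseval, parseval_shift S c j₀ N hS, sub_zero]
  rw [hR, hL, ← integral_const_mul]
  refine integral_mono ((j0.sub j1).const_mul _)
    (integrable_finsetSum _ fun s _ => (i0.sub (i1 s)).const_mul (w s)) fun η => ?_
  simp only
  set P := Pf S c η with hP
  have hP0 : 0 ≤ P := Pf_nonneg _ _ _
  set X := ∏ j, Wi (η j) with hX
  set Y := ∏ j, Wt (η j) with hY
  have hX0 : 0 ≤ X := Finset.prod_nonneg fun _ _ => Wi_nonneg _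
  have hXY : ((2/π)^4)^d * X ≤ Y := prod_W_lower Wt _ (by positivity) Wt_lower η
  set lam := ∑ s ∈ B, w s * (1 - Real.cos (2 * π * ∑ j, η j * t s j)) with hlam
  have hlam0 : 0 ≤ lam := Finset.sum_nonneg fun s hs => mul_nonneg (hw s hs)
    (by linarith [Real.cos_le_one (2 * π * ∑ j, η j * t s j)])
  have hRHS : ∑ s ∈ B, w s * (Y * P - Y * P * Real.cos (2 * π * ∑ j, η j * t s j)) = Y * P * lam := by
    rw [hlam, Finset.mul_sum]
    refine Finset.sum_congr rfl fun s _ => by ring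
  rw [hRHS]
  by_cases hbox : ∀ j, |η j| ≤ 1/2
  · have h1 := hsym η hbox
    have h2 := Real.one_sub_sq_div_two_le_cos (x := 2 * π * (η j₀ * N))
    have h3 : κ / (2 * π^2) / N^2 * (1 - Real.cos (2 * π * (η j₀ * N))) ≤ lam := by
      refine le_trans ?_ h1
      calc κ / (2 * π^2) / N^2 * (1 - Real.cos (2 * π * (η j₀ * N)))
          ≤ κ / (2 * π^2) / N^2 * ((2 * π * (η j₀ * N))^2 / 2) := by
            gcongr; linarith
        _ = κ * (η j₀)^2 := by field_simp
    calc _ = (((2/π)^4)^d * X) * P * (κ / (2 * π^2) / N^2 * (1 - Real.cos (2 * π * (η j₀ * N)))) := by ring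
      _ ≤ (((2/π)^4)^d * X) * P * lam := by gcongr
      _ ≤ Y * P * lam := by gcongr
  · have : X = 0 := prod_Wi_zero η hbox
    rw [this] at hXY ⊢
    simp only [zero_mul, sub_zero, mul_zero] at hXY ⊢
    positivity

lemma Psi_eq (d : ℕ) (h : Fin d → ℝ) (hh : ∀ j, 0 < h j) (k : Fin d → ℤ)
    (x : EuclideanSpace ℝ (Fin d)) : Psi d h k x = ∏ j, bsp (x j / h j - k j) := by
  unfold Psi bsp
  refine Finset.prod_congr rfl fun j _ => ?_
  have hj := hh j
  have : x j - k j * h j = (x j / h j - k j) * h j := by field_simp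
  rw [this, abs_mul, abs_of_pos hj]
  congr 1
  field_simp

lemma bsp_pair_integral (h : ℝ) (hh : 0 < h) (a b : ℝ) :
    ∫ x : ℝ, bsp (x / h - a) * bsp (x / h - b) = h * Gt (a - b) := by
  rw [Measure.integral_comp_div (fun y => bsp (y - a) * bsp (y - b)) h, abs_of_pos hh, smul_eq_mul]
  congr 1
  rw [← integral_add_right_eq_self _ a]
  unfold Gt
  congr 1; ext y
  congr 2 <;> ring

lemma bsp_pair_integrable (h : ℝ) (hh : 0 < h) (a b : ℝ) :
    Integrable (fun x : ℝ => bsp (x / h - a) * bsp (x / h - b)) := by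
  have hc := bsp_continuous
  refine Continuous.integrable_of_hasCompactSupport (by fun_prop) ?_
  refine HasCompactSupport.intro (K := Set.Icc (h * (a - 2)) (h * (a + 2))) isCompact_Icc ?_
  intro x hx
  rw [bsp_zero, zero_mul]
  by_contra hcon
  push Not at hcon
  rw [abs_lt] at hcon
  have e : x = h * (x / h) := by field_simp
  apply hx
  constructor
  · rw [e]; gcongr; linarith [hcon.1]
  · rw [e]; gcongr; linarith [hcon.2]

lemma RK_finite (d : ℕ) (h : Fin d → ℝ) (S : Finset (Fin d → ℤ)) (c : (Fin d → ℤ) → ℝ)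
    (hc : ∀ k, k ∉ S → c k = 0) (x : EuclideanSpace ℝ (Fin d)) :
    RKfun d h c x = ∑ k ∈ S, Psi d h k x * c k := by
  unfold RKfun
  exact tsum_eq_sum fun k hk => by rw [hc k hk, mul_zero]

lemma RK_norm (d : ℕ) (h : Fin d → ℝ) (hh : ∀ j, 0 < h j) (S : Finset (Fin d → ℤ))
    (c : (Fin d → ℤ) → ℝ) (hc : ∀ k, k ∉ S → c k = 0) :
    ∫ x : EuclideanSpace ℝ (Fin d), (RKfun d h c x)^2 =
      (∏ j, h j) * ∑ k ∈ S, ∑ m ∈ S, c k * c m * ∏ j, Gt ((k j : ℝ) - (m j : ℝ)) := by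
  have h1 : ∀ x : EuclideanSpace ℝ (Fin d), (RKfun d h c x)^2 =
      (fun y : Fin d → ℝ => ∑ k ∈ S, ∑ m ∈ S, (c k * c m) *
        ∏ j, (bsp (y j / h j - k j) * bsp (y j / h j - m j)))
        ((MeasurableEquiv.toLp 2 (Fin d → ℝ)).symm x) := by
    intro x
    rw [RK_finite d h S c hc, sq, Finset.sum_mul_sum]
    refine Finset.sum_congr rfl fun k _ => Finset.sum_congr rfl fun m _ => ?_
    rw [Psi_eq d h hh, Psi_eq d h hh, Finset.prod_mul_distrib]
    have : ∀ j, (MeasurableEquiv.toLp 2 (Fin d → ℝ)).symm x j = x j := fun j => rfl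
    simp only [this]
    ring
  rw [integral_congr_ae (Filter.Eventually.of_forall h1)]
  refine ((EuclideanSpace.volume_preserving_symm_measurableEquiv_toLp (Fin d)).integral_comp'
    (fun y : Fin d → ℝ => ∑ k ∈ S, ∑ m ∈ S, (c k * c m) *
        ∏ j, (bsp (y j / h j - k j) * bsp (y j / h j - m j)))).trans ?_
  have hi : ∀ k m : Fin d → ℤ, Integrable (fun y : Fin d → ℝ => (c k * c m) *
        ∏ j, (bsp (y j / h j - k j) * bsp (y j / h j - m j))) := fun k m =>
    (Integrable.fintype_prod (f := fun j (x : ℝ) => bsp (x / h j - k j) * bsp (x / h j - m j))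
      (fun j => bsp_pair_integrable (h j) (hh j) _ _)).const_mul _
  rw [integral_finsetSum _ fun k _ => integrable_finsetSum _ fun m _ => hi k m, Finset.mul_sum]
  refine Finset.sum_congr rfl fun k _ => ?_
  rw [integral_finsetSum _ fun m _ => hi k m, Finset.mul_sum]
  refine Finset.sum_congr rfl fun m _ => ?_
  rw [integral_const_mul, integral_fintype_prod_volume_eq_prod
    (fun (j : Fin d) (x : ℝ) => bsp (x / h j - k j) * bsp (x / h j - m j))]
  simp_rw [fun j => bsp_pair_integral (h j) (hh j) (k j) (m j)]
  rw [Finset.prod_mul_distrib]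
  ring

lemma RK_grid (d : ℕ) (h : Fin d → ℝ) (hh : ∀ j, 0 < h j) (S : Finset (Fin d → ℤ))
    (c : (Fin d → ℤ) → ℝ) (hc : ∀ k, k ∉ S → c k = 0) (k : Fin d → ℤ)
    (v : EuclideanSpace ℝ (Fin d)) (t : Fin d → ℝ) (ht : ∀ j, v j = h j * t j) :
    RKfun d h c (gridPt d h k + v) =
      ∑ m ∈ S, c m * ∏ j, bsp ((k j : ℝ) - (m j : ℝ) + t j) := by
  rw [RK_finite d h S c hc]
  refine Finset.sum_congr rfl fun m _ => ?_
  rw [Psi_eq d h hh, mul_comm]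
  congr 1
  refine Finset.prod_congr rfl fun j _ => ?_
  congr 1
  have e : (gridPt d h k + v) j = k j * h j + v j := rfl
  have hj := hh j
  rw [e, ht]
  field_simp
  ring

/-- Stability II: stability of RK collocation applied to the quasi-discrete
nonlocal diffusion operator, with `h = (δ/M₀)ĥ`. -/
theorem rk_collocation_quasi_discrete_stability (d : ℕ) (hd : 1 ≤ d) (ρ : ℝ → ℝ)
    (hρ_nonneg : ∀ r, 0 ≤ ρ r)
    (hρ_mono : ∀ r₁ r₂, 0 ≤ r₁ → r₁ ≤ r₂ → ρ r₂ ≤ ρ r₁)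
    (hρ_supp : ∀ r, 1 < r → ρ r = 0)
    (hρ_mom2 : ∫ s in Metric.ball (0 : EuclideanSpace ℝ (Fin d)) 1,
        ρ ‖s‖ * ‖s‖^2 = 2 * d)
    (Ω : Set (EuclideanSpace ℝ (Fin d))) (hΩo : IsOpen Ω)
    (hΩb : Bornology.IsBounded Ω) (hΩc : IsConnected Ω)
    (δ₀ M₀ : ℝ) (hδ₀ : 0 < δ₀) (hM₀ : 0 < M₀)
    (hhat : Fin d → ℝ) (hhat_mem : ∀ j, 0 < hhat j ∧ hhat j ≤ 1)
    (hhat_max : ∃ j, hhat j = 1)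
    (B₁ : Finset (EuclideanSpace ℝ (Fin d)))
    (hB : ∀ s ∈ B₁, ‖s‖ ≤ 1 ∧ s ≠ 0) (hBsym : ∀ s ∈ B₁, -s ∈ B₁)
    (ω : EuclideanSpace ℝ (Fin d) → ℝ)
    (hω_nonneg : ∀ s ∈ B₁, 0 ≤ ω s) (hω_sym : ∀ s ∈ B₁, ω (-s) = ω s)
    (ha : ∀ ξ : EuclideanSpace ℝ (Fin d), ξ ≠ 0 →
      ∃ s ∈ B₁, 0 < ω s * ρ ‖s‖ ∧ (∑ j, s j * ξ j) ≠ 0)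
    (hb : ∀ ξ : Fin d → ℝ, (∀ j, ξ j ∈ Set.Icc (-π) π) → ξ ≠ 0 →
      0 < ∑ s ∈ B₁, ω s * ρ ‖s‖ *
            (1 - Real.cos (M₀ * ∑ j, s j * (ξ j / hhat j)))) :
    ∃ C : ℝ, 0 < C ∧ ∀ δ : ℝ, 0 < δ → δ ≤ δ₀ →
      ∀ c : (Fin d → ℤ) → ℝ,
        (∀ k, gridPt d (fun j => (δ / M₀) * hhat j) k ∉ Ω → c k = 0) →
        C * Real.sqrt (∫ x : EuclideanSpace ℝ (Fin d),
              (RKfun d (fun j => (δ / M₀) * hhat j) c x)^2) ≤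
          seqNorm d (fun j => (δ / M₀) * hhat j)
            (restrSeq d (fun j => (δ / M₀) * hhat j) Ω
              (fun x => -(quasiOp d ρ B₁ ω δ
                (RKfun d (fun j => (δ / M₀) * hhat j) c) x))) := by
  classical
  obtain ⟨j₀, hj₀⟩ := hhat_max
  set w : EuclideanSpace ℝ (Fin d) → ℝ := fun s => ω s * ρ ‖s‖ with hw
  set t : EuclideanSpace ℝ (Fin d) → Fin d → ℝ := fun s j => M₀ * s j / hhat j with ht
  have hpi := Real.pi_pos
  obtain ⟨κ, hκ, henergy⟩ := energy_lower B₁ w t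
    (fun s hs => mul_nonneg (hω_nonneg s hs) (hρ_nonneg _)) j₀ (by
      intro η hη
      obtain ⟨s, hs, h1, h2⟩ := ha ((EuclideanSpace.equiv (Fin d) ℝ).symm
        (fun j => η j * (M₀ / hhat j))) (by
          intro h0
          apply hη
          funext j
          have h3 : η j * (M₀ / hhat j) = 0 :=
            congrArg (fun v : EuclideanSpace ℝ (Fin d) => v j) h0
          have := (hhat_mem j).1
          rcases mul_eq_zero.1 h3 with h4 | h4
          · exact h4
          · exact absurd h4 (by positivity))
      refine ⟨s, hs, h1, ?_⟩
      have h3 : ∑ j, η j * t s j = ∑ j, s j * (η j * (M₀ / hhat j)) := by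
        refine Finset.sum_congr rfl fun j _ => ?_
        simp only [ht]; ring
      rw [h3]
      exact h2) (by
      intro η hη hne
      have h1 := hb (fun j => 2 * π * η j) (fun j => by
        have := abs_le.1 (hη j)
        constructor <;> nlinarith [this.1, this.2]) (by
        intro h0
        apply hne
        funext j
        have h3 : 2 * π * η j = 0 := congrFun h0 j
        rcases mul_eq_zero.1 h3 with h4 | h4
        · exact absurd h4 (by positivity)
        · exact h4)
      refine h1.trans_le (le_of_eq ?_)
      refine Finset.sum_congr rfl fun s _ => ?_
      simp only [hw]
      congr 3
      rw [Finset.mul_sum, Finset.mul_sum]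
      refine Finset.sum_congr rfl fun j _ => ?_
      simp only [ht]; ring)
  obtain ⟨K, hK, hupper⟩ := gram_upper d
  obtain ⟨R, hR, hΩR⟩ : ∃ R : ℝ, 0 < R ∧ ∀ x ∈ Ω, ‖x‖ ≤ R := by
    obtain ⟨R, hR⟩ := hΩb.exists_norm_le
    exact ⟨max R 1, by positivity, fun x hx => (hR x hx).trans (le_max_left _ _)⟩
  set D : ℝ := 2 * R * M₀ + δ₀ with hD
  have hD0 : 0 < D := by positivity
  set A : ℝ := (((2/π)^4)^2)^d with hA
  have hA0 : 0 < A := by positivity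
  set C₁ : ℝ := 2 * κ / D^2 with hC₁
  have hC₁0 : 0 < C₁ := by positivity
  refine ⟨Real.sqrt (A / K) * C₁, by positivity, fun δ hδ hδ₀' c hc => ?_⟩
  set h : Fin d → ℝ := fun j => (δ / M₀) * hhat j with hh
  have hpos : ∀ j, 0 < h j := fun j => by
    have := (hhat_mem j).1
    simp only [hh]; positivity
  have hcoord : ∀ k, gridPt d h k ∈ Ω → ∀ j, |(k j : ℝ) * h j| ≤ R := by
    intro k hk j
    refine le_trans ?_ (hΩR _ hk)
    exact PiLp.norm_apply_le (gridPt d h k) j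
  have hcoord2 : ∀ k, gridPt d h k ∈ Ω → ∀ j, |(k j : ℝ)| ≤ R / h j := by
    intro k hk j
    have := hcoord k hk j
    rw [abs_mul, abs_of_pos (hpos j)] at this
    rwa [le_div_iff₀ (hpos j)]
  have hfin : {k : Fin d → ℤ | gridPt d h k ∈ Ω}.Finite := by
    refine Set.Finite.subset (Finset.finite_toSet
      (Fintype.piFinset fun j => Finset.Icc (-⌈R / h j⌉) ⌈R / h j⌉)) ?_
    intro k hk
    rw [Finset.mem_coe, Fintype.mem_piFinset]
    intro j
    have h1 := abs_le.1 (hcoord2 k hk j)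
    have h2 := Int.le_ceil (R / h j)
    rw [Finset.mem_Icc]
    constructor
    · have : (-⌈R / h j⌉ : ℝ) ≤ k j := by linarith [h1.1]
      exact_mod_cast this
    · have : (k j : ℝ) ≤ ⌈R / h j⌉ := by linarith [h1.2]
      exact_mod_cast this
  set S : Finset (Fin d → ℤ) := hfin.toFinset with hS
  have hSmem : ∀ k, k ∈ S ↔ gridPt d h k ∈ Ω := fun k => by
    rw [hS, Set.Finite.mem_toFinset]; rfl
  have hcS : ∀ k, k ∉ S → c k = 0 := fun k hk => hc k (fun h' => hk ((hSmem k).2 h'))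
  set u := RKfun d h c with hu
  set f := restrSeq d h Ω (fun x => -(quasiOp d ρ B₁ ω δ u x)) with hf
  have hfS : ∀ k, k ∉ S → f k = 0 := fun k hk => by
    simp only [hf, restrSeq]
    rw [if_neg (fun h' => hk ((hSmem k).2 h'))]
  have hfval : ∀ k ∈ S, f k = 2 / δ^2 * ∑ s ∈ B₁, w s *
      ((∑ m ∈ S, c m * ∏ j, bsp ((k j : ℝ) - (m j : ℝ))) -
        ∑ m ∈ S, c m * ∏ j, bsp ((k j : ℝ) - (m j : ℝ) + t s j)) := by
    intro k hk
    simp only [hf, restrSeq]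
    rw [if_pos ((hSmem k).1 hk)]
    unfold quasiOp
    rw [← mul_neg, ← Finset.sum_neg_distrib, Finset.mul_sum, Finset.mul_sum]
    refine Finset.sum_congr rfl fun s _ => ?_
    have e1 : u (gridPt d h k + δ • s) =
        ∑ m ∈ S, c m * ∏ j, bsp ((k j : ℝ) - (m j : ℝ) + t s j) := by
      refine RK_grid d h hpos S c hcS k _ _ fun j => ?_
      have := (hhat_mem j).1
      have e : (δ • s) j = δ * s j := rfl
      rw [e]
      simp only [hh, ht]
      field_simp
    have e2 : u (gridPt d h k) =
        ∑ m ∈ S, c m * ∏ j, bsp ((k j : ℝ) - (m j : ℝ)) := by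
      have := RK_grid d h hpos S c hcS k 0 (fun _ => 0) (fun j => by simp)
      simpa using this
    rw [e1, e2]
    unfold rhoScaled
    rw [mul_div_cancel_left₀ _ hδ.ne']
    simp only [hw]
    field_simp
    ring
  set N : ℕ := ⌊2 * R / h j₀⌋₊ + 1 with hN
  have hNsep : ∀ k ∈ S, ∀ m ∈ S, k j₀ - m j₀ + (N : ℤ) ≠ 0 := by
    intro k hk m hm h0
    have h1 := abs_le.1 (hcoord2 k ((hSmem k).1 hk) j₀)
    have h2 := abs_le.1 (hcoord2 m ((hSmem m).1 hm) j₀)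
    have h3 : 2 * R / h j₀ < N := by
      rw [hN]; push_cast; exact Nat.lt_floor_add_one _
    have h4 : (k j₀ : ℝ) - m j₀ + N = 0 := by exact_mod_cast h0
    have h5 : 2 * R / h j₀ = R / h j₀ + R / h j₀ := by ring
    linarith [h1.1, h2.2]
  have hE := henergy S c N (Nat.succ_pos _) hNsep
  have hδN : δ * N ≤ D := by
    have h1 : (N : ℝ) ≤ 2 * R / h j₀ + 1 := by
      rw [hN]; push_cast
      have := hpos j₀
      gcongr
      exact Nat.floor_le (by positivity)
    calc δ * N ≤ δ * (2 * R / h j₀ + 1) := by gcongr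
      _ = 2 * R * M₀ + δ := by
          simp only [hh, hj₀]
          field_simp
      _ ≤ D := by rw [hD]; linarith
  have hN0 : (0:ℝ) < N := by exact_mod_cast Nat.succ_pos _
  have hc2 : 0 ≤ ∑ k ∈ S, (c k)^2 := Finset.sum_nonneg fun _ _ => sq_nonneg _
  have hinner : C₁ * ∑ k ∈ S, (c k)^2 ≤ ∑ k ∈ S, c k * f k := by
    have e1 : ∑ k ∈ S, c k * f k = 2 / δ^2 * ∑ s ∈ B₁, w s *
        ((∑ k ∈ S, ∑ m ∈ S, c k * c m * ∏ j, bsp ((k j : ℝ) - (m j : ℝ))) -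
          (∑ k ∈ S, ∑ m ∈ S, c k * c m * ∏ j, bsp ((k j : ℝ) - (m j : ℝ) + t s j))) := by
      rw [Finset.sum_congr rfl fun k hk => by rw [hfval k hk]]
      have e2 : ∀ k, c k * (2 / δ^2 * ∑ s ∈ B₁, w s *
          ((∑ m ∈ S, c m * ∏ j, bsp ((k j : ℝ) - (m j : ℝ))) -
          ∑ m ∈ S, c m * ∏ j, bsp ((k j : ℝ) - (m j : ℝ) + t s j))) =
          2 / δ^2 * ∑ s ∈ B₁, w s * (c k *
          ((∑ m ∈ S, c m * ∏ j, bsp ((k j : ℝ) - (m j : ℝ))) -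
          ∑ m ∈ S, c m * ∏ j, bsp ((k j : ℝ) - (m j : ℝ) + t s j))) := by
        intro k
        rw [mul_left_comm, Finset.mul_sum]
        congr 1
        exact Finset.sum_congr rfl fun s _ => by ring
      rw [Finset.sum_congr rfl fun k _ => e2 k, ← Finset.mul_sum]
      congr 1
      rw [Finset.sum_comm]
      refine Finset.sum_congr rfl fun s _ => ?_
      rw [← Finset.sum_sub_distrib, Finset.mul_sum]
      refine Finset.sum_congr rfl fun k _ => ?_
      rw [mul_sub, Finset.mul_sum, Finset.mul_sum]
      simp only [mul_assoc]
    rw [e1]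
    calc C₁ * ∑ k ∈ S, (c k)^2 ≤ 2 / δ^2 * (κ / N^2) * ∑ k ∈ S, (c k)^2 := by
          gcongr
          rw [hC₁, div_mul_div_comm, ← mul_pow]
          gcongr
      _ = 2 / δ^2 * (κ / N^2 * ∑ k ∈ S, (c k)^2) := by ring
      _ ≤ _ := by gcongr
  have hCS := Finset.sum_mul_sq_le_sq_mul_sq S c f
  have hf2 : C₁^2 * ∑ k ∈ S, (c k)^2 ≤ ∑ k ∈ S, (f k)^2 := by
    rcases eq_or_lt_of_le hc2 with h0 | h0
    · rw [← h0, mul_zero]; exact Finset.sum_nonneg fun _ _ => sq_nonneg _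
    · have h1 : (C₁ * ∑ k ∈ S, (c k)^2)^2 ≤ (∑ k ∈ S, (c k)^2) * ∑ k ∈ S, (f k)^2 :=
        le_trans (by gcongr) hCS
      refine le_of_mul_le_mul_left ?_ h0
      calc _ = (C₁ * ∑ k ∈ S, (c k)^2)^2 := by ring
        _ ≤ _ := h1
  unfold seqNorm
  rw [RK_norm d h hpos S f hfS, RK_norm d h hpos S c hcS]
  have hV : 0 < ∏ j, h j := Finset.prod_pos fun j _ => hpos j
  have hup := hupper S c
  have hlow := gram_lower S f
  rw [← Real.sqrt_sq hC₁0.le, ← Real.sqrt_mul (by positivity), ← Real.sqrt_mul (by positivity)]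
  apply Real.sqrt_le_sqrt
  calc A / K * C₁^2 * ((∏ j, h j) * ∑ k ∈ S, ∑ m ∈ S, c k * c m * ∏ j, Gt ((k j : ℝ) - (m j : ℝ)))
      ≤ A / K * C₁^2 * ((∏ j, h j) * (K * ∑ k ∈ S, (c k)^2)) := by gcongr
    _ = (∏ j, h j) * (A * (C₁^2 * ∑ k ∈ S, (c k)^2)) := by field_simp
    _ ≤ (∏ j, h j) * (A * ∑ k ∈ S, (f k)^2) := by gcongr
    _ ≤ _ := by gcongr

end
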